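/- The set of holomorphic functions g : ℂ \ {0} → ℂ with the property that g(S) = ℂ for every triangular region S with vertex at 0 is comeagre in H(ℂ \ {0}). Here a triangular region with vertex at 0 is a set of the form S = {ρ e^{iθ} : 0 < ρ < δ, |θ − θ_0| < α} for some δ > 0, θ_0 ∈ ℝ and 0 < α < π, and g(S) = ℂ means that g assumes every complex value on S. -/

import Mathlib

open Complex Set Topology Filter

/-- The space of functions holomorphic on `Ω`, with the topology of
uniform convergence on compact subsets of `Ω`. -/
def Hol (Ω : Set ℂ) : Type := {g : ℂ → ℂ // DifferentiableOn ℂ g Ω}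

noncomputable instance (Ω : Set ℂ) : TopologicalSpace (Hol Ω) :=
  TopologicalSpace.induced
    (fun g => UniformOnFun.ofFun {K : Set ℂ | K ⊆ Ω ∧ IsCompact K} g.1)
    inferInstance

theorem hol_nhds_of_compact {Ω : Set ℂ} (g : Hol Ω) {K : Set ℂ} (hK : K ⊆ Ω) (hc : IsCompact K)
    {ε : ℝ} (hε : 0 < ε) : {f : Hol Ω | ∀ z ∈ K, dist (g.1 z) (f.1 z) < ε} ∈ 𝓝 g := by
  rw [nhds_induced]
  refine ⟨_, UniformOnFun.gen_mem_nhds (β := ℂ) (𝔖 := {K : Set ℂ | K ⊆ Ω ∧ IsCompact K})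
    (UniformOnFun.ofFun {K : Set ℂ | K ⊆ Ω ∧ IsCompact K} g.1) (s := K) ⟨hK, hc⟩
    (Metric.dist_mem_uniformity hε), ?_⟩
  intro f hf z hz
  exact hf z hz

theorem hol_exists_compact {Ω : Set ℂ} (g : Hol Ω) {s : Set (Hol Ω)} (hs : s ∈ 𝓝 g) :
    ∃ K : Set ℂ, K ⊆ Ω ∧ IsCompact K ∧ ∃ ε : ℝ, 0 < ε ∧
      ∀ f : Hol Ω, (∀ z ∈ K, dist (g.1 z) (f.1 z) < ε) → f ∈ s := by
  rw [nhds_induced] at hs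
  obtain ⟨t, ht, hts⟩ := hs
  have hb := UniformOnFun.hasBasis_nhds_of_basis ℂ ℂ {K : Set ℂ | K ⊆ Ω ∧ IsCompact K}
    (UniformOnFun.ofFun {K : Set ℂ | K ⊆ Ω ∧ IsCompact K} g.1)
    ⟨∅, empty_subset _, isCompact_empty⟩
    (by
      intro A hA B hB
      exact ⟨A ∪ B, ⟨union_subset hA.1 hB.1, hA.2.union hB.2⟩, subset_union_left,
        subset_union_right⟩)
    Metric.uniformity_basis_dist
  obtain ⟨⟨K, ε⟩, ⟨⟨hK, hKc⟩, hε⟩, hsub⟩ := hb.mem_iff.1 ht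
  refine ⟨K, hK, hKc, ε, hε, fun f hf => hts (hsub ?_)⟩
  intro z hz
  show dist (f.1 z) (g.1 z) < ε
  rw [dist_comm]; exact hf z hz

/-- The triangular region. -/
def secT (δ θ0 α : ℝ) : Set ℂ :=
  {z | ∃ ρ θ : ℝ, 0 < ρ ∧ ρ < δ ∧ |θ - θ0| < α ∧ (ρ : ℂ) * Complex.exp ((θ : ℂ) * Complex.I) = z}

theorem secT_nhds {δ θ0 α s : ℝ} (hα : 0 < α) (hs : 0 < s) (hsδ : s < δ) :
    ∀ᶠ z in 𝓝 ((s : ℂ) * Complex.exp ((θ0 : ℂ) * Complex.I)), z ∈ secT δ θ0 α := by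
  set w := (s : ℂ) * Complex.exp ((θ0 : ℂ) * Complex.I) with hw
  have hwn : ‖w‖ = s := by
    rw [hw, norm_mul, Complex.norm_exp_ofReal_mul_I, mul_one, Complex.norm_real, Real.norm_eq_abs,
      abs_of_pos hs]
  have hE : Complex.exp (-((θ0 : ℂ) * Complex.I)) * Complex.exp ((θ0 : ℂ) * Complex.I) = 1 := by
    rw [← Complex.exp_add]; simp
  have hws : w * Complex.exp (-((θ0 : ℂ) * Complex.I)) = s := by
    rw [hw]; linear_combination (s : ℂ) * hE
  have hcont : ContinuousAt (fun z : ℂ => (z * Complex.exp (-((θ0 : ℂ) * Complex.I))).arg) w := by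
    have h1 : ContinuousAt Complex.arg (w * Complex.exp (-((θ0 : ℂ) * Complex.I))) := by
      rw [hws]
      exact Complex.continuousAt_arg (by simp [hs])
    exact ContinuousAt.comp (f := fun z : ℂ => z * Complex.exp (-((θ0 : ℂ) * Complex.I))) h1
      (by fun_prop)
  have h0 : (w * Complex.exp (-((θ0 : ℂ) * Complex.I))).arg = 0 := by
    rw [hws]; exact Complex.arg_ofReal_of_nonneg hs.le
  have e1 : ∀ᶠ z in 𝓝 w, |(z * Complex.exp (-((θ0 : ℂ) * Complex.I))).arg| < α := by
    have := hcont.abs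
    refine this.eventually_lt (continuousAt_const (y := α)) ?_
    simp only [h0, abs_zero]; exact hα
  have e2 : ∀ᶠ z in 𝓝 w, ‖z‖ < δ :=
    continuous_norm.continuousAt.eventually_lt (continuousAt_const (y := δ)) (by rw [hwn]; exact hsδ)
  have e3 : ∀ᶠ z in 𝓝 w, 0 < ‖z‖ :=
    (continuousAt_const (y := (0:ℝ))).eventually_lt continuous_norm.continuousAt
      (by rw [hwn]; exact hs)
  filter_upwards [e1, e2, e3] with z h1 h2 h3
  refine ⟨‖z‖, θ0 + (z * Complex.exp (-((θ0 : ℂ) * Complex.I))).arg, h3, h2, by simpa using h1, ?_⟩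
  have hn : ‖z * Complex.exp (-((θ0 : ℂ) * Complex.I))‖ = ‖z‖ := by
    rw [norm_mul]
    have : -((θ0 : ℂ) * Complex.I) = ((-θ0 : ℝ) : ℂ) * Complex.I := by push_cast; ring
    rw [this, Complex.norm_exp_ofReal_mul_I, mul_one]
  have hp := Complex.norm_mul_exp_arg_mul_I (z * Complex.exp (-((θ0 : ℂ) * Complex.I)))
  rw [hn] at hp
  push_cast
  rw [add_mul, Complex.exp_add]
  linear_combination Complex.exp ((θ0 : ℂ) * Complex.I) * hp + z * hE

/-- The functions which robustly cover the disc of radius `m` on a sector. -/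
def covT (δ θ0 α m : ℝ) : Set (Hol ({0}ᶜ : Set ℂ)) :=
  {g | ∃ (w : ℂ) (η e : ℝ), 0 < η ∧ Metric.closedBall w η ⊆ secT δ θ0 α ∧
    2 * (m + ‖g.1 w‖) < e ∧ ∀ z ∈ Metric.sphere w η, e ≤ ‖g.1 z - g.1 w‖}

theorem secT_sub (δ θ0 α : ℝ) : secT δ θ0 α ⊆ ({0}ᶜ : Set ℂ) := by
  rintro z ⟨ρ, θ, h, -, -, rfl⟩
  simp [h.ne', Complex.exp_ne_zero]

theorem covT_open (δ θ0 α m : ℝ) : IsOpen (covT δ θ0 α m) := by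
  rw [isOpen_iff_mem_nhds]
  rintro g ⟨w, η, e, hη, hS, he, hsp⟩
  have hκ : 0 < (e - 2 * (m + ‖g.1 w‖)) / 8 := by linarith
  filter_upwards [hol_nhds_of_compact g (hS.trans (secT_sub _ _ _)) (isCompact_closedBall w η) hκ]
    with f hf
  set κ := (e - 2 * (m + ‖g.1 w‖)) / 8 with hκd
  have hfw := hf w (Metric.mem_closedBall_self hη.le)
  rw [dist_eq_norm] at hfw
  refine ⟨w, η, e - 2 * κ, hη, hS, ?_, ?_⟩
  · have : ‖f.1 w‖ ≤ ‖g.1 w‖ + ‖g.1 w - f.1 w‖ := by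
      have := norm_sub_le (g.1 w) (g.1 w - f.1 w)
      simpa using this
    linarith
  · intro z hz
    have hfz := hf z (Metric.sphere_subset_closedBall hz)
    rw [dist_eq_norm] at hfz
    have h1 := hsp z hz
    have h2 : ‖g.1 z - g.1 w‖ ≤ ‖g.1 z - f.1 z‖ + ‖f.1 z - f.1 w‖ + ‖g.1 w - f.1 w‖ := by
      have h3 := norm_sub_le ((g.1 z - f.1 z) + (f.1 z - f.1 w)) (g.1 w - f.1 w)
      have h4 := norm_add_le (g.1 z - f.1 z) (f.1 z - f.1 w)
      have h5 : (g.1 z - f.1 z) + (f.1 z - f.1 w) - (g.1 w - f.1 w) = g.1 z - g.1 w := by ring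
      rw [h5] at h3
      linarith
    linarith

theorem covT_cover {δ θ0 α m : ℝ} {g : Hol ({0}ᶜ : Set ℂ)} (hg : g ∈ covT δ θ0 α m) {c : ℂ}
    (hc : ‖c‖ ≤ m) : ∃ z ∈ secT δ θ0 α, g.1 z = c := by
  obtain ⟨w, η, e, hη, hS, he, hsp⟩ := hg
  have hd : DiffContOnCl ℂ g.1 (Metric.ball w η) := by
    refine DifferentiableOn.diffContOnCl ?_
    rw [closure_ball _ hη.ne']
    exact g.2.mono (hS.trans (secT_sub _ _ _))
  have hne : ∃ᶠ z in 𝓝 w, g.1 z ≠ g.1 w := by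
    intro hev
    have hev' : ∀ᶠ z in 𝓝 w, g.1 z = g.1 w := by
      filter_upwards [hev] with z hz using not_not.1 hz
    have hopen : AnalyticOnNhd ℂ g.1 (Metric.ball w η) :=
      hd.differentiableOn.analyticOnNhd Metric.isOpen_ball
    have heq := hopen.eqOn_of_preconnected_of_eventuallyEq (g := fun _ => g.1 w)
      analyticOnNhd_const (convex_ball w η).isPreconnected (Metric.mem_ball_self hη) hev'
    have heq2 : EqOn g.1 (fun _ => g.1 w) (closure (Metric.ball w η)) :=
      heq.of_subset_closure hd.continuousOn continuousOn_const subset_closure subset_rfl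
    have hz : w + (η : ℂ) ∈ Metric.sphere w η := by simp [abs_of_pos hη]
    have h1 := hsp _ hz
    rw [heq2 (by rw [closure_ball _ hη.ne']; exact Metric.sphere_subset_closedBall hz)] at h1
    have h2 : 0 ≤ ‖g.1 w‖ := norm_nonneg _
    have h3 : 0 ≤ ‖c‖ := norm_nonneg _
    simp at h1
    linarith
  have hcov := hd.ball_subset_image_closedBall hη hsp hne
  have hcm : c ∈ Metric.ball (g.1 w) (e / 2) := by
    rw [Metric.mem_ball, dist_eq_norm]
    have := norm_sub_le c (g.1 w)
    linarith
  obtain ⟨z, hz, rfl⟩ := hcov hcm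
  exact ⟨z, hS hz, rfl⟩

theorem covT_dense {δ θ0 α m : ℝ} (hδ : 0 < δ) (hα : 0 < α) (hm : 0 ≤ m) :
    Dense (covT δ θ0 α m) := by
  intro g
  rw [mem_closure_iff_nhds]
  intro T hT
  obtain ⟨K, hK, hKc, ε, hε, hsub⟩ := hol_exists_compact g hT
  obtain ⟨r, hr, hrK⟩ : ∃ r : ℝ, 0 < r ∧ ∀ z ∈ K, r ≤ ‖z‖ := by
    have h0 : Kᶜ ∈ 𝓝 (0 : ℂ) := hKc.isClosed.isOpen_compl.mem_nhds (fun h => hK h rfl)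
    obtain ⟨r, hr, hb⟩ := Metric.mem_nhds_iff.1 h0
    refine ⟨r, hr, fun z hz => ?_⟩
    by_contra hlt
    exact hb (by simpa using hlt) hz
  set s := min δ r / 2 with hs
  have hs0 : 0 < s := by have := lt_min hδ hr; positivity
  have hsδ : s < δ := by have := min_le_left δ r; linarith
  have hsr : s ≤ r / 2 := by have := min_le_right δ r; linarith
  set w := (s : ℂ) * Complex.exp ((θ0 : ℂ) * Complex.I) with hw
  have hwn : ‖w‖ = s := by
    rw [hw, norm_mul, Complex.norm_exp_ofReal_mul_I, mul_one, Complex.norm_real, Real.norm_eq_abs,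
      abs_of_pos hs0]
  set t := 3 * r / 4 with ht
  have ht0 : 0 < t := by positivity
  have e2 : ∀ᶠ z in 𝓝 w, ‖z‖ < t :=
    continuous_norm.continuousAt.eventually_lt (continuousAt_const (y := t)) (by rw [hwn]; linarith)
  obtain ⟨η, hη, hball⟩ := Metric.nhds_basis_closedBall.eventually_iff.1
    ((secT_nhds hα hs0 hsδ).and e2)
  have hS : Metric.closedBall w η ⊆ secT δ θ0 α := fun z hz => (hball hz).1
  obtain ⟨C, hC⟩ := (isCompact_closedBall w η).exists_bound_of_continuousOn
    (g.2.continuousOn.mono (hS.trans (secT_sub _ _ _)))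
  have hC0 : 0 ≤ C := (norm_nonneg _).trans (hC w (Metric.mem_closedBall_self hη.le))
  set B := (2 * m + 4 * C + 1) / η with hB
  have hB0 : 0 < B := by positivity
  have hBη : B * η = 2 * m + 4 * C + 1 := by rw [hB]; field_simp
  have hlim : Tendsto (fun N : ℕ => 2 * B * t * (t / r) ^ N) atTop (𝓝 (2 * B * t * 0)) := by
    refine (tendsto_pow_atTop_nhds_zero_of_lt_one (by positivity) ?_).const_mul _
    rw [div_lt_one hr]; linarith
  rw [mul_zero] at hlim
  obtain ⟨N, hN⟩ := (hlim.eventually_lt_const hε).exists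
  let h : ℂ → ℂ := fun z => B * (z - w) * ((t : ℂ) / z) ^ (N + 1)
  have hdiff : DifferentiableOn ℂ (fun z => g.1 z + h z) ({0}ᶜ : Set ℂ) := by
    refine g.2.add ?_
    intro z hz
    have hz' : z ≠ 0 := hz
    have : DifferentiableAt ℂ h z := by
      have h1 : DifferentiableAt ℂ (fun z : ℂ => (t : ℂ) / z) z :=
        (differentiableAt_const _).div differentiableAt_id hz'
      exact (DifferentiableAt.mul (by fun_prop) (h1.pow _))
    exact this.differentiableWithinAt
  have hhn : ∀ z, ‖h z‖ = B * ‖z - w‖ * (t / ‖z‖) ^ (N + 1) := by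
    intro z
    simp [h, abs_of_pos hB0, abs_of_pos ht0]
  refine ⟨⟨_, hdiff⟩, hsub _ ?_, w, η, B * η - 2 * C, hη, hS, ?_, ?_⟩
  · intro z hz
    have hrz := hrK z hz
    have hz0 : 0 < ‖z‖ := hr.trans_le hrz
    refine lt_of_le_of_lt ?_ hN
    show dist (g.1 z) (g.1 z + h z) ≤ _
    rw [dist_self_add_right, hhn]
    have h1 : ‖z - w‖ ≤ 2 * ‖z‖ := by
      have := norm_sub_le z w
      linarith
    have h2 : (t / ‖z‖) ^ N ≤ (t / r) ^ N := by gcongr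
    calc B * ‖z - w‖ * (t / ‖z‖) ^ (N + 1) ≤ B * (2 * ‖z‖) * (t / ‖z‖) ^ (N + 1) := by gcongr
      _ = 2 * B * t * (t / ‖z‖) ^ N := by rw [pow_succ]; field_simp
      _ ≤ _ := by gcongr
  · have hw0 : g.1 w + h w = g.1 w := by simp [h]
    show 2 * (m + ‖g.1 w + h w‖) < _
    rw [hw0, hBη]
    have := hC w (Metric.mem_closedBall_self hη.le)
    linarith
  · intro z hz
    have hw0 : g.1 w + h w = g.1 w := by simp [h]
    show _ ≤ ‖(g.1 z + h z) - (g.1 w + h w)‖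
    rw [hw0]
    have hzc := Metric.sphere_subset_closedBall hz
    have hz0 : 0 < ‖z‖ := norm_pos_iff.2 (secT_sub _ _ _ (hS hzc))
    have hzt : ‖z‖ < t := (hball hzc).2
    have h1 : B * η ≤ ‖h z‖ := by
      rw [hhn, mem_sphere_iff_norm.1 hz]
      exact le_mul_of_one_le_right (by positivity)
        (one_le_pow₀ ((one_le_div hz0).2 hzt.le))
    have h2 := norm_sub_le ((g.1 z + h z) - g.1 w) (g.1 z - g.1 w)
    have h3 : (g.1 z + h z) - g.1 w - (g.1 z - g.1 w) = h z := by ring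
    rw [h3] at h2
    have h4 := norm_sub_le (g.1 z) (g.1 w)
    have h5 := hC z hzc
    have h6 := hC w (Metric.mem_closedBall_self hη.le)
    linarith

theorem stmt16 :
    {g : Hol ({0}ᶜ : Set ℂ) |
        ∀ δ : ℝ, 0 < δ → ∀ θ0 α : ℝ, 0 < α → α < Real.pi → ∀ c : ℂ,
          ∃ ρ θ : ℝ, 0 < ρ ∧ ρ < δ ∧ |θ - θ0| < α ∧
            g.1 ((ρ : ℂ) * Complex.exp ((θ : ℂ) * Complex.I)) = c}
      ∈ residual (Hol ({0}ᶜ : Set ℂ)) := by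
  have key : ∀ᶠ g in residual (Hol ({0}ᶜ : Set ℂ)), ∀ p : ℕ × ℚ × ℕ × ℕ,
      g ∈ covT (1 / ((p.1 : ℝ) + 1)) (p.2.1 : ℝ) (1 / ((p.2.2.1 : ℝ) + 1)) (p.2.2.2 : ℝ) := by
    rw [eventually_countable_forall]
    intro p
    exact residual_of_dense_open (covT_open _ _ _ _)
      (covT_dense (by positivity) (by positivity) (by positivity))
  filter_upwards [key] with g hg
  intro δ hδ θ0 α hα _ c
  obtain ⟨n, hn⟩ := exists_nat_one_div_lt hδ
  obtain ⟨k, hk⟩ := exists_nat_one_div_lt (half_pos hα)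
  obtain ⟨m, hm⟩ := exists_nat_ge ‖c‖
  obtain ⟨q, hq1, hq2⟩ := exists_rat_btwn (show θ0 < θ0 + α / 2 by linarith)
  obtain ⟨z, ⟨ρ, θ, h1, h2, h3, rfl⟩, hz⟩ := covT_cover (hg (n, q, k, m)) hm
  refine ⟨ρ, θ, h1, h2.trans hn, ?_, hz⟩
  simp only at h3
  rw [abs_lt] at h3 ⊢
  constructor <;> linarith [h3.1, h3.2]
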